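/- Let A be a non-degenerate deterministic allocation rule for the MAB mechanism design problem which is scale-free, pointwise monotone, and satisfies IIA. Then A is exploration-separated if and only if it is weakly separated. -/

import Mathlib

open Finset

namespace MAB

/-- A realization of clicks: for each agent and each round, whether the agent
would be clicked if shown at that round. -/
abbrev Realization (k T : ℕ) := Fin k → Fin T → Bool

/-- A deterministic allocation rule: maps a bid profile, a realization and a round
to the agent chosen at that round. -/
abbrev Alloc (k T : ℕ) := (Fin k → ℝ) → Realization k T → Fin T → Fin k

/-- A payment rule: maps a bid profile and a realization to the payment
charged to each agent. -/
abbrev Payment (k T : ℕ) := (Fin k → ℝ) → Realization k T → Fin k → ℝ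

variable {k T : ℕ}

/-- A bid profile consists of positive reals. -/
def PosBids (b : Fin k → ℝ) : Prop := ∀ i, 0 < b i

/-- The allocation rule is online: the choice at round `t` is determined by the bids
and the bits observed at rounds `s < t`. -/
def Online (A : Alloc k T) : Prop :=
  ∀ (b : Fin k → ℝ) (ρ ρ' : Realization k T) (t : Fin T),
    (∀ s : Fin T, s < t → ρ (A b ρ s) s = ρ' (A b ρ s) s) → A b ρ t = A b ρ' t

/-- The click-allocation: the number of rounds in which agent `i` is chosen and clicked. -/
def clicks (A : Alloc k T) (b : Fin k → ℝ) (ρ : Realization k T) (i : Fin k) : ℕ :=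
  (univ.filter fun t : Fin T => A b ρ t = i ∧ ρ i t = true).card

/-- The payment rule only uses clicks actually observed by the allocation rule. -/
def PaymentObservable (A : Alloc k T) (P : Payment k T) : Prop :=
  ∀ (b : Fin k → ℝ) (ρ ρ' : Realization k T),
    (∀ t : Fin T, ρ (A b ρ t) t = ρ' (A b ρ t) t) → P b ρ = P b ρ'

/-- The mechanism is normalized: `0 ≤ P_i(b;ρ) ≤ b_i · C_i(b;ρ)`. -/
def Normalized (A : Alloc k T) (P : Payment k T) : Prop :=
  ∀ (b : Fin k → ℝ) (ρ : Realization k T) (i : Fin k), PosBids b →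
    0 ≤ P b ρ i ∧ P b ρ i ≤ b i * (clicks A b ρ i : ℝ)

/-- The mechanism is truthful: bidding the true value dominates any other bid. -/
def Truthful (A : Alloc k T) (P : Payment k T) : Prop :=
  ∀ (b : Fin k → ℝ) (ρ : Realization k T) (i : Fin k) (v : ℝ), PosBids b → 0 < v →
    v * (clicks A (Function.update b i v) ρ i : ℝ) - P (Function.update b i v) ρ i ≥
      v * (clicks A b ρ i : ℝ) - P b ρ i

/-- Pointwise monotonicity: an agent that is played keeps the impression
after increasing her bid. -/
def PointwiseMonotone (A : Alloc k T) : Prop :=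
  ∀ (b : Fin k → ℝ) (ρ : Realization k T) (t : Fin T) (i : Fin k) (x : ℝ),
    PosBids b → A b ρ t = i → b i < x → A (Function.update b i x) ρ t = i

/-- `flip ρ i t` is `ρ ⊕ 1(i,t)`: the realization with the bit of agent `i`
at round `t` flipped. -/
def flip (ρ : Realization k T) (i : Fin k) (t : Fin T) : Realization k T :=
  fun j s => if j = i ∧ s = t then !(ρ j s) else ρ j s

/-- Round `t` is `(b;ρ)`-influential. -/
def InfluentialAt (A : Alloc k T) (b : Fin k → ℝ) (ρ : Realization k T) (t : Fin T) : Prop :=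
  ∃ t' : Fin T, t < t' ∧ A b ρ t' ≠ A b (flip ρ (A b ρ t) t) t'

/-- Round `t` is influential for realization `ρ`. -/
def Influential (A : Alloc k T) (ρ : Realization k T) (t : Fin T) : Prop :=
  ∃ b : Fin k → ℝ, PosBids b ∧ InfluentialAt A b ρ t

/-- The allocation rule is exploration-separated: in any influential round
the allocation does not depend on the bids. -/
def ExplorationSeparated (A : Alloc k T) : Prop :=
  ∀ (ρ : Realization k T) (t : Fin T), Influential A ρ t →
    ∀ b b' : Fin k → ℝ, PosBids b → PosBids b' → A b ρ t = A b' ρ t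

/-- Round `t` is `(b;ρ)`-influential with influenced agent `i`. -/
def InfluencedAgent (A : Alloc k T) (b : Fin k → ℝ) (ρ : Realization k T) (t : Fin T)
    (i : Fin k) : Prop :=
  ∃ t' : Fin T, t < t' ∧ A b ρ t' ≠ A b (flip ρ (A b ρ t) t) t' ∧
    (i = A b ρ t' ∨ i = A b (flip ρ (A b ρ t) t) t')

/-- Round `t` is `(b;ρ)`-secured from agent `i`. -/
def SecuredFrom (A : Alloc k T) (b : Fin k → ℝ) (ρ : Realization k T) (t : Fin T)
    (i : Fin k) : Prop :=
  ∀ x : ℝ, b i < x → A (Function.update b i x) ρ t = A b ρ t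

/-- The allocation rule is weakly separated. -/
def WeaklySeparated (A : Alloc k T) : Prop :=
  ∀ (b : Fin k → ℝ) (ρ : Realization k T) (t : Fin T) (i : Fin k),
    PosBids b → InfluencedAgent A b ρ t i → SecuredFrom A b ρ t i

/-- Non-degeneracy of the allocation rule. -/
def NonDegenerate (A : Alloc k T) : Prop :=
  ∀ (b : Fin k → ℝ) (ρ : Realization k T) (t t' : Fin T), PosBids b → t ≤ t' →
    ∃ l u : ℝ, l < u ∧ l ≤ b (A b ρ t) ∧ b (A b ρ t) ≤ u ∧
      ∀ x ∈ Set.Icc l u, ∀ φ ∈ ({ρ, flip ρ (A b ρ t) t} : Set (Realization k T)),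
        ∀ s ∈ ({t, t'} : Set (Fin T)),
          (A (Function.update b (A b ρ t) x) φ s = A b ρ t ↔ A b φ s = A b ρ t)

/-- The allocation rule is scale-free. -/
def ScaleFree (A : Alloc k T) : Prop :=
  ∀ (c : ℝ) (b : Fin k → ℝ) (ρ : Realization k T) (t : Fin T), 0 < c → PosBids b →
    A (fun j => c * b j) ρ t = A b ρ t

/-- Independence of irrelevant alternatives. -/
def IIA (A : Alloc k T) : Prop :=
  ∀ (b : Fin k → ℝ) (ρ : Realization k T) (t : Fin T) (i : Fin k) (x : ℝ),
    PosBids b → 0 < x → A b ρ t ≠ A (Function.update b i x) ρ t →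
    (A b ρ t = i ∨ A (Function.update b i x) ρ t = i)

/-- Round `t` is bid-independent w.r.t. realization `ρ`. -/
def BidIndependent (A : Alloc k T) (ρ : Realization k T) (t : Fin T) : Prop :=
  ∀ b b' : Fin k → ℝ, PosBids b → PosBids b' → A b ρ t = A b' ρ t

/-- The probability of realization `ρ` when clicks are independent Bernoulli
with CTR vector `μ`. -/
noncomputable def prob (μ : Fin k → ℝ) (ρ : Realization k T) : ℝ :=
  ∏ i : Fin k, ∏ t : Fin T, if ρ i t then μ i else 1 - μ i

/-- A valid CTR vector: all entries in `[0,1]`. -/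
def ValidCTR (μ : Fin k → ℝ) : Prop := ∀ i, 0 ≤ μ i ∧ μ i ≤ 1

/-- A valid value profile: all values in `(0, vmax]`. -/
def ValidValues (vmax : ℝ) (v : Fin k → ℝ) : Prop := ∀ i, 0 < v i ∧ v i ≤ vmax

/-- The regret of allocation rule `A` on the instance with CTRs `μ` and values `v`
(bids equal to the true values). -/
noncomputable def regret (A : Alloc k T) (μ v : Fin k → ℝ) : ℝ :=
  (T : ℝ) * (⨆ i : Fin k, μ i * v i) -
    ∑ ρ : Realization k T, prob μ ρ * ∑ t : Fin T, μ (A v ρ t) * v (A v ρ t)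

/-- The worst-case regret `R(T; vmax)`. -/
noncomputable def worstRegret (A : Alloc k T) (vmax : ℝ) : ℝ :=
  sSup {r : ℝ | ∃ μ v : Fin k → ℝ, ValidCTR μ ∧ ValidValues vmax v ∧ r = regret A μ v}

/-- The instance `(μ, v)` has `δ`-gap: the largest product `μ_i v_i` exceeds
the second largest by `δ · max_i v_i`. -/
def HasGap (μ v : Fin k → ℝ) (δ : ℝ) : Prop :=
  ∃ i : Fin k, (∀ j, μ j * v j ≤ μ i * v i) ∧
    μ i * v i - (⨆ j : {j : Fin k // j ≠ i}, μ j.1 * v j.1) = δ * (⨆ j : Fin k, v j)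

/-- The worst-case regret over `δ`-gap instances, `R_δ(T; vmax)`. -/
noncomputable def worstGapRegret (A : Alloc k T) (vmax δ : ℝ) : ℝ :=
  sSup {r : ℝ | ∃ μ v : Fin k → ℝ,
    ValidCTR μ ∧ ValidValues vmax v ∧ HasGap μ v δ ∧ r = regret A μ v}

/-- The properties of the choice made at a fixed round and realization, as a function of
the bids, that the argument relies on. -/
structure RegularChoice (F : (Fin k → ℝ) → Fin k) : Prop where
  mono : ∀ b i x, PosBids b → F b = i → b i < x → F (Function.update b i x) = i
  iia : ∀ b i x, PosBids b → 0 < x →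
    F (Function.update b i x) = F b ∨ F b = i ∨ F (Function.update b i x) = i
  scale : ∀ (c : ℝ) b, 0 < c → PosBids b → F (fun j => c * b j) = F b

theorem PosBids.update {b : Fin k → ℝ} (hb : PosBids b) (i : Fin k) {x : ℝ} (hx : 0 < x) :
    PosBids (Function.update b i x) := by
  intro j
  rcases eq_or_ne j i with rfl | hj
  · simpa using hx
  · simpa [hj] using hb j

namespace RegularChoice

variable {F G₁ G₂ : (Fin k → ℝ) → Fin k}

/-- Lowering the bid of an agent that is not chosen does not change the choice. -/
theorem update_of_le (hF : RegularChoice F) {b : Fin k → ℝ} (hb : PosBids b) {j : Fin k}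
    (hj : F b ≠ j) {x : ℝ} (hx : 0 < x) (hxb : x ≤ b j) :
    F (Function.update b j x) = F b := by
  rcases hxb.eq_or_lt with rfl | hlt
  · simp
  rcases hF.iia b j x hb hx with h | h | h
  · exact h
  · exact absurd h hj
  · have := hF.mono _ j (b j) (hb.update j hx) h (by simpa using hlt)
    simp only [Function.update_idem, Function.update_eq_self] at this
    exact absurd this hj

/-- The chosen agent remains chosen if her bid rises and all other bids fall. -/
theorem eq_of_le (hF : RegularChoice F) {b b' : Fin k → ℝ} (hb : PosBids b) (hb' : PosBids b')
    (hi : b (F b) ≤ b' (F b)) (hj : ∀ j, j ≠ F b → b' j ≤ b j) : F b' = F b := by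
  have key : ∀ s : Finset (Fin k), F (s.piecewise b' b) = F b := by
    intro s
    induction s using Finset.induction_on with
    | empty => simp
    | insert a s ha ih =>
      have hpos : PosBids (s.piecewise b' b) := fun m => by
        by_cases hm : m ∈ s <;> simp [hm, hb m, hb' m]
      rw [Finset.piecewise_insert]
      rcases eq_or_ne a (F b) with rfl | hne
      · rcases hi.eq_or_lt with h | h
        · rwa [← h, Function.update_eq_self_iff.2 (by simp [ha])]
        · exact hF.mono _ _ _ hpos ih (by simpa [ha] using h)
      · rw [hF.update_of_le hpos (by rw [ih]; exact hne.symm) (hb' a) (by simpa [ha] using hj a hne),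
          ih]
  simpa using key univ

/-- The chosen agent remains chosen if all bids relative to hers fall. -/
theorem eq_of_ratio_le (hF : RegularChoice F) {b b' : Fin k → ℝ} (hb : PosBids b)
    (hb' : PosBids b') {i : Fin k} (hi : F b = i) (h : ∀ j, b' j * b i ≤ b j * b' i) :
    F b' = i := by
  have hc : 0 < b' i / b i := div_pos (hb' i) (hb i)
  have hs := (hF.scale _ b hc hb).trans hi
  have hle := hF.eq_of_le (b := fun j => b' i / b i * b j) (b' := b')
    (fun j => mul_pos hc (hb j)) hb'
  rw [hs] at hle
  refine hle (div_mul_cancel₀ _ (hb i).ne').le fun j _ => ?_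
  rw [div_mul_eq_mul_div, le_div_iff₀ (hb i), mul_comm (b' i)]
  exact h j

/-- An agent chosen for some bids is chosen whenever her own bid is large enough. -/
theorem exists_update_eq (hF : RegularChoice F) {b b' : Fin k → ℝ} (hb : PosBids b)
    (hb' : PosBids b') : ∃ y, b (F b') < y ∧ F (Function.update b (F b') y) = F b' := by
  obtain ⟨M, hM⟩ := Finite.exists_le fun j => b j * b' (F b') / b' j
  have hlt : b (F b') < max M (b (F b') + 1) := lt_max_of_lt_right (lt_add_one _)
  refine ⟨_, hlt, hF.eq_of_ratio_le hb' (hb.update _ ((hb _).trans hlt)) rfl fun j => ?_⟩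
  rcases eq_or_ne j (F b') with rfl | hj
  · simp [mul_comm]
  · have := (hM j).trans (le_max_left M (b (F b') + 1))
    rw [div_le_iff₀ (hb' j)] at this
    simpa [hj, mul_comm] using this

/-- If two choices are distinct agents `j₁`, `j₂` and `F` chooses `i` whenever one of them raises
her bid, then raising the bid of a further agent `l` cannot win her the choice `F`,
provided the two choices coincide whenever `F` does not choose `i`. -/
theorem update_ne_of_secured (hF : RegularChoice F) (hG₁ : RegularChoice G₁)
    (hG₂ : RegularChoice G₂) {b : Fin k → ℝ} (hb : PosBids b) {i j₁ j₂ l : Fin k}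
    (h₁ : G₁ b = j₁) (h₂ : G₂ b = j₂) (hj : j₁ ≠ j₂) (hij₁ : j₁ ≠ i)
    (hij₂ : j₂ ≠ i) (hlj₁ : l ≠ j₁) (hlj₂ : l ≠ j₂) (hli : l ≠ i)
    (hagree : ∀ c, F c ≠ i → G₁ c = G₂ c)
    (hs₁ : ∀ x, b j₁ < x → F (Function.update b j₁ x) = i)
    (hs₂ : ∀ x, b j₂ < x → F (Function.update b j₂ x) = i) {y : ℝ} (hy : b l < y) :
    F (Function.update b l y) ≠ l := by
  intro hl
  have hy0 : 0 < y := (hb l).trans hy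
  obtain ⟨c, hc, rfl⟩ : ∃ c, 1 < c ∧ c * b l = y :=
    ⟨y / b l, (one_lt_div (hb l)).2 hy, div_mul_cancel₀ _ (hb l).ne'⟩
  have hc0 : 0 < c := one_pos.trans hc
  have hraise : ∀ j, b j < c * b j := fun j => lt_mul_of_one_lt_left (hb j) hc
  have hpos : ∀ j, 0 < c * b j := fun j => mul_pos hc0 (hb j)
  set b₁ := Function.update b j₁ (c * b j₁) with hb₁
  set b₂ := Function.update b j₂ (c * b j₂) with hb₂
  set b₁₂ := Function.update b₁ j₂ (c * b j₂) with hb₁₂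
  have hcomm : b₁₂ = Function.update b₂ j₁ (c * b j₁) := Function.update_comm hj _ _ _
  have hb₁pos : PosBids b₁ := hb.update _ (hpos _)
  have hb₂pos : PosBids b₂ := hb.update _ (hpos _)
  have hb₁₂pos : PosBids b₁₂ := hb₁pos.update _ (hpos _)
  have hFb₁₂ : F b₁₂ = i := by
    have e₁ := hF.iia b₁ j₂ _ hb₁pos (hpos j₂)
    have e₂ := hF.iia b₂ j₁ _ hb₂pos (hpos j₁)
    rw [← hcomm, hs₂ _ (hraise _)] at e₂
    rw [← hb₁₂, hs₁ _ (hraise _)] at e₁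
    grind
  set e := Function.update b l (c * b l) with he
  set d := Function.update b₁₂ l (c * b l) with hd
  have hepos : PosBids e := hb.update _ (hpos _)
  have hdpos : PosBids d := hb₁₂pos.update _ (hpos _)
  have hde : d = Function.update (Function.update e j₁ (c * b j₁)) j₂ (c * b j₂) := by
    rw [hd, hb₁₂, hb₁, Function.update_comm hlj₂.symm, Function.update_comm hlj₁.symm]
  have hFd : F d = l := by
    have e₁ := hF.iia e j₁ _ hepos (hpos j₁)
    have e₂ := hF.iia _ j₂ _ (hepos.update j₁ (hpos j₁)) (hpos j₂)
    have e₃ := hF.iia b₁₂ l _ hb₁₂pos (hpos l)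
    rw [← hde] at e₂
    rw [← hd] at e₃
    grind
  have hle : ∀ m, d m ≤ c * b m := by
    intro m
    have := (hraise m).le
    simp only [hd, hb₁₂, hb₁, Function.update_apply]
    split_ifs <;> simp_all
  have hd₁ : d j₁ = c * b j₁ := by simp [hd, hb₁₂, hb₁, hlj₁.symm, hj]
  have hd₂ : d j₂ = c * b j₂ := by simp [hd, hb₁₂, hlj₂.symm]
  have hratio : ∀ m j, d j = c * b j → d m * b j ≤ b m * d j := fun m j h => by
    rw [h]
    nlinarith [mul_le_mul_of_nonneg_right (hle m) (hb j).le]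
  have hG₁d := hG₁.eq_of_ratio_le hb hdpos h₁ fun m => hratio m j₁ hd₁
  have hG₂d := hG₂.eq_of_ratio_le hb hdpos h₂ fun m => hratio m j₂ hd₂
  have := hagree d (by rw [hFd]; exact hli)
  exact hj (by rw [← hG₁d, ← hG₂d, this])

/-- If `G₁` chooses `j` and `G₂` chooses `i` both before and after `i` raises her bid, and `G₁`
and `G₂` choose a third agent `l` for the same bids, then no bid wins `l` the choice `G₁`. -/
theorem update_ne_of_iff (hG₁ : RegularChoice G₁) (hG₂ : RegularChoice G₂) {b : Fin k → ℝ}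
    (hb : PosBids b) {i j l : Fin k} {v : ℝ} (hv : b i < v) (h₁ : G₁ b = j)
    (h₁' : G₁ (Function.update b i v) = j) (h₂ : G₂ b = i) (hij : j ≠ i) (hli : l ≠ i)
    (hiff : ∀ c, PosBids c → (G₁ c = l ↔ G₂ c = l)) {y : ℝ} (hy : 0 < y) :
    G₁ (Function.update b l y) ≠ l := by
  intro hl
  have hi0 : 0 < b i := hb i
  have hv0 : 0 < v := hi0.trans hv
  set d := Function.update b i v with hd
  have hdpos : PosBids d := hb.update i hv0
  have step : ∀ y, 0 < y → G₁ (Function.update b l y) = l →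
      G₁ (Function.update b l (y * (b i / v))) = l := by
    intro y hy hl
    set z := y * (b i / v) with hz
    have hzv : z * v = y * b i := by rw [hz]; field_simp
    have hz0 : 0 < z := mul_pos hy (div_pos hi0 hv0)
    have hbz := hb.update l hz0
    have hdy := hdpos.update l hy
    have hG₁d : G₁ (Function.update d l y) = l := by
      have e₁ := hG₁.iia _ i v (hb.update l hy) hv0
      have e₂ := hG₁.iia d l y hdpos hy
      rw [Function.update_comm hli, ← hd] at e₁
      grind
    have hG₂d := (hiff _ hdy).1 hG₁d
    rw [hiff _ hbz]
    by_contra hne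
    have hG₂z : G₂ (Function.update b l z) = i := by
      have := hG₂.iia b l z hb hz0
      grind
    refine hli (hG₂d.symm.trans (hG₂.eq_of_ratio_le hbz hdy hG₂z fun m => ?_))
    rcases eq_or_ne m l with rfl | hml
    · simp [hli.symm, hd, hzv]
    · rcases eq_or_ne m i with rfl | hmi
      · simp [hml, hd, mul_comm]
      · simpa [hml, hmi, hli.symm, hd] using mul_le_mul_of_nonneg_left hv.le (hb m).le
  have hr0 : 0 < b i / v := div_pos hi0 hv0
  have iter : ∀ n : ℕ, G₁ (Function.update b l (y * (b i / v) ^ n)) = l := by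
    intro n
    induction n with
    | zero => simpa using hl
    | succ n ih => simpa [pow_succ, mul_assoc] using step _ (by positivity) ih
  obtain ⟨n, hn⟩ := exists_pow_lt_of_lt_one (div_pos (hb l) hy) ((div_lt_one hv0).2 hv)
  rw [lt_div_iff₀ hy, mul_comm] at hn
  have hn0 : 0 < y * (b i / v) ^ n := by positivity
  have hlow := hG₂.update_of_le hb (j := l) (by rw [h₂]; exact hli.symm) hn0 hn.le
  exact hli (((hiff _ (hb.update l hn0)).1 (iter n)).symm.trans (hlow.trans h₂))

end RegularChoice

theorem regularChoice {A : Alloc k T} (hSF : ScaleFree A) (hPM : PointwiseMonotone A)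
    (hIIA : IIA A) (ρ : Realization k T) (t : Fin T) : RegularChoice fun b => A b ρ t where
  mono b i x hb h hx := hPM b ρ t i x hb h hx
  iia b i x hb hx := by
    rcases eq_or_ne (A b ρ t) (A (Function.update b i x) ρ t) with h | h
    · exact Or.inl h.symm
    · exact Or.inr (hIIA b ρ t i x hb hx h)
  scale c b hc hb := hSF c b ρ t hc hb

/-- A bit that is not observed does not affect the allocation. -/
theorem Online.flip_eq_of_ne {A : Alloc k T} (hA : Online A) {b : Fin k → ℝ}
    {ρ : Realization k T} {i : Fin k} {t : Fin T} (h : A b ρ t ≠ i) (t' : Fin T) :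
    A b ρ t' = A b (flip ρ i t) t' := by
  refine hA b ρ _ t' fun s _ => ?_
  rw [flip, if_neg]
  rintro ⟨hs, rfl⟩
  exact h hs

/-- Non-degeneracy makes the choices `j ≠ i` and `i` at a later round, before and after flipping
the bit observed at round `t`, persist for two distinct bids of `i`. -/
theorem NonDegenerate.exists_raise {A : Alloc k T} (hND : NonDegenerate A) (hIIA : IIA A)
    {b : Fin k → ℝ} (hb : PosBids b) {ρ φ ψ : Realization k T} {t t' : Fin T} (ht : t ≤ t')
    (hφ : φ = ρ ∨ φ = flip ρ (A b ρ t) t) (hψ : ψ = ρ ∨ ψ = flip ρ (A b ρ t) t)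
    (hj : A b φ t' ≠ A b ρ t) (hi : A b ψ t' = A b ρ t) :
    ∃ c v, PosBids c ∧ c (A b ρ t) < v ∧ A c φ t' = A b φ t' ∧
      A (Function.update c (A b ρ t) v) φ t' = A b φ t' ∧ A c ψ t' = A b ρ t := by
  obtain ⟨p, q, hpq, hp, hq, h⟩ := hND b ρ t t' hb ht
  generalize A b ρ t = i at *
  have key : ∀ x ∈ Set.Icc p q, 0 < x → A (Function.update b i x) φ t' = A b φ t' ∧
      A (Function.update b i x) ψ t' = i := by
    intro x hx hx0
    have hxφ := h x hx φ (by simpa using hφ) t' (by simp)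
    have hxψ := h x hx ψ (by simpa using hψ) t' (by simp)
    refine ⟨?_, hxψ.2 hi⟩
    by_contra hne
    rcases hIIA b φ t' i x hb hx0 (Ne.symm hne) with h' | h'
    · exact hj h'
    · exact hj (hxφ.1 h')
  rcases hq.lt_or_eq with hlt | heq
  · exact ⟨b, q, hb, hlt, rfl, (key q ⟨hpq.le, le_rfl⟩ ((hb i).trans hlt)).1, hi⟩
  · have hbi := hb i
    have hlt : max p (b i / 2) < b i := max_lt (heq ▸ hpq) (half_lt_self hbi)
    have h0 : 0 < max p (b i / 2) := lt_max_of_lt_right (half_pos hbi)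
    obtain ⟨hk₁, hk₂⟩ := key _ ⟨le_max_left _ _, hlt.le.trans hq⟩ h0
    exact ⟨_, b i, hb.update i h0, by simpa using hlt, hk₁, by simp, hk₂⟩

theorem ExplorationSeparated.weaklySeparated {A : Alloc k T} (h : ExplorationSeparated A) :
    WeaklySeparated A := by
  rintro b ρ t i hb ⟨t', ht, hne, -⟩ x hx
  exact h ρ t ⟨b, hb, t', ht, hne⟩ _ _ (hb.update i ((hb i).trans hx)) hb

theorem WeaklySeparated.explorationSeparated {A : Alloc k T} (hWS : WeaklySeparated A)
    (hOnline : Online A) (hND : NonDegenerate A) (hSF : ScaleFree A)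
    (hPM : PointwiseMonotone A) (hIIA : IIA A) : ExplorationSeparated A := by
  rintro ρ t ⟨b, hb, t', ht, hne⟩
  suffices H : ∀ b', PosBids b' → A b' ρ t = A b ρ t from
    fun b₁ b₂ h₁ h₂ => (H b₁ h₁).trans (H b₂ h₂).symm
  intro b' hb'
  by_contra hli
  have hreg := regularChoice hSF hPM hIIA
  obtain ⟨i, hi⟩ : ∃ i, A b ρ t = i := ⟨_, rfl⟩
  obtain ⟨l, hl⟩ : ∃ l, A b' ρ t = l := ⟨_, rfl⟩
  have hwin : ∀ c, PosBids c → ∃ y, c l < y ∧ A (Function.update c l y) ρ t = l :=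
    fun c hc => hl ▸ (hreg ρ t).exists_update_eq hc hb'
  rw [hi, hl] at hli
  have hsec : ∀ c, PosBids c → A c ρ t = i → A c ρ t' ≠ A c (flip ρ i t) t' →
      ∀ j, (j = A c ρ t' ∨ j = A c (flip ρ i t) t') → SecuredFrom A c ρ t j :=
    fun c hc hci hcne j hj =>
      hWS c ρ t j hc ⟨t', ht, by rwa [hci], by rwa [hci]⟩
  have hagree : ∀ c, A c ρ t ≠ i → A c ρ t' = A c (flip ρ i t) t' :=
    fun c hc => hOnline.flip_eq_of_ne hc t'
  have hnot : ∀ c, PosBids c → A c ρ t = i → ¬ SecuredFrom A c ρ t l := by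
    intro c hc hci hs
    obtain ⟨y, hy, hyl⟩ := hwin c hc
    exact hli (hyl.symm.trans ((hs y hy).trans hci))
  have hiff : ∀ c, PosBids c → (A c ρ t' = l ↔ A c (flip ρ i t) t' = l) := by
    intro c hc
    by_cases hci : A c ρ t = i
    · by_cases heq : A c ρ t' = A c (flip ρ i t) t'
      · rw [heq]
      · have := hsec c hc hci heq l
        have := hnot c hc hci
        grind
    · rw [hagree c hci]
  have hcross : ∀ φ ψ, (φ = ρ ∧ ψ = flip ρ i t ∨ φ = flip ρ i t ∧ ψ = ρ) →
      A b φ t' ≠ i → A b ψ t' ≠ i := by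
    intro φ ψ hφψ hj hψi
    obtain ⟨c, v, hc, hv, h₁, h₁', h₂⟩ := hND.exists_raise hIIA hb (φ := φ) (ψ := ψ) ht.le
      (by rw [hi]; tauto) (by rw [hi]; tauto) (by rwa [hi]) (by rwa [hi])
    rw [hi] at hv h₁' h₂
    have hiff' : ∀ c, PosBids c → (A c φ t' = l ↔ A c ψ t' = l) := by
      rcases hφψ with ⟨rfl, rfl⟩ | ⟨rfl, rfl⟩
      · exact hiff
      · exact fun c hc => (hiff c hc).symm
    obtain ⟨y, hy, hyl⟩ := hwin c hc
    have hy0 : 0 < y := (hc l).trans hy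
    have hag : A (Function.update c l y) φ t' = A (Function.update c l y) ψ t' := by
      have := hagree (Function.update c l y) (by rw [hyl]; exact hli)
      rcases hφψ with ⟨rfl, rfl⟩ | ⟨rfl, rfl⟩
      · exact this
      · exact this.symm
    refine (hreg φ t').update_ne_of_iff (hreg ψ t') hc hv h₁ h₁' h₂ hj hli hiff' hy0 ?_
    have e₁ := (hreg φ t').iia c l y hc hy0
    have e₂ := (hreg ψ t').iia c l y hc hy0
    grind
  rw [hi] at hne
  have hn₁ : A b ρ t' ≠ i := fun h => by
    have := hcross (flip ρ i t) ρ (by tauto)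
    grind
  have hn₂ : A b (flip ρ i t) t' ≠ i := hcross ρ _ (by tauto) hn₁
  have hs₁ := hsec b hb hi hne _ (Or.inl rfl)
  have hs₂ := hsec b hb hi hne _ (Or.inr rfl)
  obtain ⟨y, hy, hyl⟩ := hwin b hb
  refine (hreg ρ t).update_ne_of_secured (hreg ρ t') (hreg (flip ρ i t) t') hb rfl rfl hne
    hn₁ hn₂ ?_ ?_ hli hagree (fun x hx => (hs₁ x hx).trans hi) (fun x hx => (hs₂ x hx).trans hi)
    hy hyl
  · intro h
    exact hnot b hb hi (h ▸ hs₁)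
  · intro h
    exact hnot b hb hi (h ▸ hs₂)

/-- A non-degenerate deterministic allocation rule which is scale-free,
pointwise monotone and satisfies IIA is exploration-separated iff it is weakly separated. -/
theorem exploration_separated_iff_weakly_separated (k T : ℕ) (A : Alloc k T)
    (hOnline : Online A) (hND : NonDegenerate A) (hSF : ScaleFree A)
    (hPM : PointwiseMonotone A) (hIIA : IIA A) :
    ExplorationSeparated A ↔ WeaklySeparated A := by
  exact ⟨ExplorationSeparated.weaklySeparated, fun h =>
    h.explorationSeparated hOnline hND hSF hPM hIIA⟩

end MAB
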